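/- For every integer m ≥ 0, the eigenspace {u a function on K_{m+1} : −Δ_{m+1} u = 3u} has dimension exactly 5^m + 1, and every function u in this eigenspace vanishes at all old vertices, i.e., u(5n) = 0 for every n ∈ ℤ/N_mℤ (taking 5n in ℤ/N_{m+1}ℤ). -/

import Mathlib

open scoped BigOperators

noncomputable section

namespace VNLE

/-- `N_m = 2·5^m`, the number of points on the circle at level `m`. -/
def Nm (m : ℕ) : ℕ := 2 * 5 ^ m

/-- The partner of a vertex `n` of `K_m`: writing the representative `v` of `n`
(taking `v = 2·5^m` when `n = 0`) as `v = 5^k·a` with `5 ∤ a`, the partner is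
`n + 5^k` if `a ≡ 1` or `3 (mod 5)`, and `n - 5^k` if `a ≡ 2` or `4 (mod 5)`.
This realizes the identifications `5^k(1+5j) ∼ 5^k(2+5j)` and
`5^k(3+5j) ∼ 5^k(4+5j)` in `ℤ/(2·5^m)ℤ`. -/
def partner (m : ℕ) (n : ZMod (Nm m)) : ZMod (Nm m) :=
  let v : ℕ := if n.val = 0 then Nm m else n.val
  let k : ℕ := padicValNat 5 v
  if (v / 5 ^ k) % 5 = 1 ∨ (v / 5 ^ k) % 5 = 3 then n + ((5 ^ k : ℕ) : ZMod (Nm m))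
  else n - ((5 ^ k : ℕ) : ZMod (Nm m))

/-- A function on `K_m`: a map on `ℤ/N_mℤ` constant on the identified pairs. -/
def IsKFun (m : ℕ) (u : ZMod (Nm m) → ℝ) : Prop := ∀ n, u (partner m n) = u n

/-- The graph Laplacian `−Δ_m`. -/
def lap (m : ℕ) (u : ZMod (Nm m) → ℝ) : ZMod (Nm m) → ℝ := fun n =>
  4 * u n - u (n + 1) - u (n - 1) - u (partner m n + 1) - u (partner m n - 1)

/-- `u` is a `λ`-eigenfunction of `−Δ_m`. -/
def IsEigen (m : ℕ) (lam : ℝ) (u : ZMod (Nm m) → ℝ) : Prop :=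
  IsKFun m u ∧ u ≠ 0 ∧ ∀ n, lap m u n = lam * u n

/-- The spectral decimation renormalization polynomial `R(x) = x(3−x)(5−x)`. -/
def R (x : ℝ) : ℝ := x * (3 - x) * (5 - x)

/-- The `λ'`-extension of a function on `K_m` to a function on `K_{m+1}`. -/
def extFun (m : ℕ) (lam' : ℝ) (u : ZMod (Nm m) → ℝ) : ZMod (Nm (m + 1)) → ℝ := fun x =>
  let n : ZMod (Nm m) := ((x.val / 5 : ℕ) : ZMod (Nm m))
  if x.val % 5 = 0 then u n
  else if x.val % 5 = 1 ∨ x.val % 5 = 2 then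
    ((2 - lam') * u n + u (n + 1)) / ((1 - lam') * (3 - lam'))
  else
    (u n + (2 - lam') * u (n + 1)) / ((1 - lam') * (3 - lam'))

/-- Restriction of a function on `K_{m+1}` to the old vertices, giving a function on `K_m`. -/
def down (m : ℕ) (v : ZMod (Nm (m + 1)) → ℝ) : ZMod (Nm m) → ℝ := fun n =>
  v (((5 * n.val : ℕ) : ZMod (Nm (m + 1))))

/-- The Laplacian `−Δ_m` as a linear map. -/
def lapL (m : ℕ) : (ZMod (Nm m) → ℝ) →ₗ[ℝ] (ZMod (Nm m) → ℝ) where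
  toFun := lap m
  map_add' u v := by funext n; simp only [lap, Pi.add_apply]; ring
  map_smul' c u := by funext n; simp only [lap, Pi.smul_apply, smul_eq_mul, RingHom.id_apply]; ring

/-- The subspace of functions on `K_m` (maps constant on identified pairs). -/
def KFunSub (m : ℕ) : Submodule ℝ (ZMod (Nm m) → ℝ) where
  carrier := {u | IsKFun m u}
  add_mem' := by
    intro u v hu hv n
    simp only [Pi.add_apply, hu n, hv n]
  zero_mem' := fun _ => rfl
  smul_mem' := by
    intro c u hu n
    simp only [Pi.smul_apply, hu n]

/-- The `λ`-eigenspace of `−Δ_m` inside the space of functions on `K_m`. -/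
def eigensp (m : ℕ) (lam : ℝ) : Submodule ℝ (ZMod (Nm m) → ℝ) :=
  LinearMap.ker (lapL m - lam • LinearMap.id) ⊓ KFunSub m

/-- `c = (8 − √19)/3`, the smaller critical point of `R`. -/
def cpt : ℝ := (8 - Real.sqrt 19) / 3

/-- `φ₁`, the inverse of the (strictly increasing) restriction of `R` to `[0, c]`. -/
def phi1 : ℝ → ℝ := Function.invFunOn R (Set.Icc 0 cpt)

/-- Eigenvalue counting function: total dimension of the eigenspaces of `−Δ_m`
with eigenvalue `≤ t`. -/
def evCount (m : ℕ) (t : ℝ) : ℕ :=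
  Module.finrank ℝ ↥(⨆ lam ∈ Set.Iic t, eigensp m lam)

/-- `evSorted m k = λ_k(m)`, the `k`-th smallest eigenvalue (with multiplicity,
`1 ≤ k ≤ 5^m`) of `−Δ_m` acting on functions on `K_m`. -/
def evSorted (m k : ℕ) : ℝ := sInf {t : ℝ | k ≤ evCount m t}

/-- The restriction of a function on the circle `ℝ/ℤ` to the level-`m` vertices. -/
def restr (u : AddCircle (1 : ℝ) → ℝ) (m : ℕ) : ZMod (Nm m) → ℝ := fun n =>
  u (((n.val : ℝ) / (Nm m : ℝ) : ℝ) : AddCircle (1 : ℝ))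

/-- A continuous function on the circle is admissible if at every level its values
agree on identified pairs, so that its restrictions are functions on `K_m`. -/
def Admissible (u : AddCircle (1 : ℝ) → ℝ) : Prop :=
  Continuous u ∧ ∀ m, 1 ≤ m → ∀ n : ZMod (Nm m), restr u m (partner m n) = restr u m n

/-- `u` is a `λ`-eigenfunction of `−Δ` on `K`: it is admissible, nonzero, and
`sup_n |15^m (−Δ_m u_m)(n) − λ u(n/N_m)| → 0` as `m → ∞`. -/
def IsEigenK (lam : ℝ) (u : AddCircle (1 : ℝ) → ℝ) : Prop :=
  Admissible u ∧ u ≠ 0 ∧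
    ∀ ε : ℝ, 0 < ε → ∃ M : ℕ, ∀ m, M ≤ m → ∀ n : ZMod (Nm m),
      |(15 : ℝ) ^ m * lap m (restr u m) n - lam * restr u m n| < ε

/-- The symmetry-type subspace `V_{ε₁,ε₂}` of functions on `K_m`. -/
def symSub (m : ℕ) (e1 e2 : ℝ) : Submodule ℝ (ZMod (Nm m) → ℝ) where
  carrier := {u | IsKFun m u ∧ (∀ n, u (-n) = e1 * u n) ∧
    (∀ n, u (((5 ^ m : ℕ) : ZMod (Nm m)) - n) = e2 * u n)}
  add_mem' := by
    rintro u v ⟨hu, hu1, hu2⟩ ⟨hv, hv1, hv2⟩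
    refine ⟨fun n => by simp only [Pi.add_apply, hu n, hv n],
      fun n => by simp only [Pi.add_apply, hu1 n, hv1 n]; ring,
      fun n => by simp only [Pi.add_apply, hu2 n, hv2 n]; ring⟩
  zero_mem' := ⟨fun _ => rfl, fun n => by simp, fun n => by simp⟩
  smul_mem' := by
    rintro c u ⟨hu, hu1, hu2⟩
    refine ⟨fun n => by simp only [Pi.smul_apply, hu n],
      fun n => by simp only [Pi.smul_apply, smul_eq_mul, hu1 n]; ring,
      fun n => by simp only [Pi.smul_apply, smul_eq_mul, hu2 n]; ring⟩

instance Nm.instNeZero (m : ℕ) : NeZero (Nm m) := ⟨by unfold Nm; positivity⟩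

lemma Nm_succ (m : ℕ) : Nm (m + 1) = 5 * Nm m := by unfold Nm; ring

lemma partner_natCast (m k a : ℕ) (ha : a % 5 ≠ 0) (h : 5 ^ k * a ≤ Nm m) :
    partner m ((5 ^ k * a : ℕ) : ZMod (Nm m)) =
      if a % 5 = 1 ∨ a % 5 = 3 then ((5 ^ k * (a + 1) : ℕ) : ZMod (Nm m))
      else ((5 ^ k * (a - 1) : ℕ) : ZMod (Nm m)) := by
  have ha0 : 0 < a := by omega
  have hpos : 0 < 5 ^ k * a := by positivity
  have hv : (if ((5 ^ k * a : ℕ) : ZMod (Nm m)).val = 0 then Nm m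
      else ((5 ^ k * a : ℕ) : ZMod (Nm m)).val) = 5 ^ k * a := by
    rw [ZMod.val_natCast]
    rcases h.lt_or_eq with h | h
    · rw [Nat.mod_eq_of_lt h, if_neg hpos.ne']
    · rw [h, Nat.mod_self, if_pos rfl]
  have hk : padicValNat 5 (5 ^ k * a) = k := by
    have : Fact (Nat.Prime 5) := ⟨by norm_num⟩
    rw [padicValNat.mul (by positivity) ha0.ne', padicValNat.prime_pow,
      padicValNat.eq_zero_of_not_dvd (by omega), add_zero]
  have hdiv : 5 ^ k * a / 5 ^ k = a := Nat.mul_div_cancel_left _ (by positivity)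
  unfold partner
  simp only [hv, hk, hdiv]
  split_ifs
  · push_cast; ring
  · obtain ⟨b, rfl⟩ : ∃ b, a = b + 1 := ⟨a - 1, by omega⟩
    push_cast [Nat.add_sub_cancel]; ring

lemma exists_eq_natCast_pow_mul (m : ℕ) (q : ZMod (Nm m)) :
    ∃ k a : ℕ, a % 5 ≠ 0 ∧ 5 ^ k * a ≤ Nm m ∧ q = ((5 ^ k * a : ℕ) : ZMod (Nm m)) := by
  obtain ⟨v, hv0, hv, rfl⟩ : ∃ v : ℕ, v ≠ 0 ∧ v ≤ Nm m ∧ q = (v : ZMod (Nm m)) := by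
    by_cases h : q.val = 0
    · exact ⟨Nm m, NeZero.ne _, le_rfl, by simpa using h⟩
    · exact ⟨q.val, h, (ZMod.val_lt q).le, by simp⟩
  obtain ⟨k, a, ha, rfl⟩ := Nat.exists_eq_pow_mul_and_not_dvd hv0 5 (by norm_num)
  exact ⟨k, a, by omega, hv, rfl⟩

lemma pow_mul_succ_le {m k a : ℕ} (ha : a % 5 = 1 ∨ a % 5 = 3) (h : 5 ^ k * a ≤ Nm m) :
    5 ^ k * (a + 1) ≤ Nm m := by
  have hkm : k ≤ m := by
    have h1 : 5 ^ k < 5 ^ (m + 1) := by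
      calc 5 ^ k ≤ 5 ^ k * a := Nat.le_mul_of_pos_right _ (by omega)
        _ ≤ 2 * 5 ^ m := h
        _ < 5 ^ (m + 1) := by rw [pow_succ]; have : 0 < 5 ^ m := by positivity
                              omega
    have := (Nat.pow_lt_pow_iff_right (by norm_num : 1 < 5)).1 h1
    omega
  obtain ⟨j, rfl⟩ := Nat.exists_eq_add_of_le hkm
  have hN : Nm (k + j) = 5 ^ k * (2 * 5 ^ j) := by unfold Nm; ring
  rw [hN] at h ⊢
  refine Nat.mul_le_mul_left _ ?_
  have h2 := Nat.le_of_mul_le_mul_left h (by positivity)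
  rcases j with _ | j
  · omega
  · rw [pow_succ] at h2 ⊢
    omega

lemma partner_involutive (m : ℕ) : Function.Involutive (partner m) := by
  intro q
  obtain ⟨k, a, ha, h, rfl⟩ := exists_eq_natCast_pow_mul m q
  rw [partner_natCast m k a ha h]
  split_ifs with hc
  · rw [partner_natCast m k _ (by omega) (pow_mul_succ_le hc h), if_neg (by omega),
      Nat.add_sub_cancel]
  · rw [partner_natCast m k _ (by omega) ((Nat.mul_le_mul_left _ (Nat.sub_le a 1)).trans h),
      if_pos (by omega), Nat.sub_add_cancel (by omega)]

lemma val_partner_mod_two (m : ℕ) (q : ZMod (Nm m)) :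
    (partner m q).val % 2 ≠ q.val % 2 := by
  have hd : 2 ∣ Nm m := ⟨5 ^ m, rfl⟩
  have key : ∀ x : ZMod (Nm m), ((x.val : ℕ) : ZMod 2) = ZMod.castHom hd (ZMod 2) x := by
    intro x
    rw [ZMod.castHom_apply, ZMod.natCast_val]
  have h5 : (5 : ZMod 2) = 1 := rfl
  intro h
  rw [← ZMod.natCast_eq_natCast_iff', key, key] at h
  unfold partner at h
  simp only at h
  split_ifs at h <;>
    simp only [map_add, map_sub, map_pow, map_ofNat, Nat.cast_pow, Nat.cast_ofNat, h5, one_pow] at h <;>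
    simp at h

/-- The embedding `n ↦ 5n` of `ℤ/N_mℤ` as the old vertices of `ℤ/N_{m+1}ℤ`. -/
def old (m : ℕ) (q : ZMod (Nm m)) : ZMod (Nm (m + 1)) := ((5 * q.val : ℕ) : ZMod (Nm (m + 1)))

lemma old_natCast (m n : ℕ) : old m (n : ZMod (Nm m)) = ((5 * n : ℕ) : ZMod (Nm (m + 1))) := by
  rw [old, ZMod.natCast_eq_natCast_iff', ZMod.val_natCast, Nm_succ, Nat.mul_mod_mul_left,
    Nat.mul_mod_mul_left, Nat.mod_mod]

lemma old_add_one (m : ℕ) (q : ZMod (Nm m)) : old m (q + 1) = old m q + 5 := by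
  have h : q + 1 = ((q.val + 1 : ℕ) : ZMod (Nm m)) := by simp
  rw [h, old_natCast, old]
  push_cast; ring

lemma old_sub_one (m : ℕ) (q : ZMod (Nm m)) : old m (q - 1) = old m q - 5 := by
  rw [eq_sub_iff_add_eq, ← old_add_one, sub_add_cancel]

lemma val_old_add (m r : ℕ) (hr : r < 5) (q : ZMod (Nm m)) :
    (old m q + r).val = 5 * q.val + r := by
  rw [old, ← Nat.cast_add, ZMod.val_natCast, Nat.mod_eq_of_lt]
  have := ZMod.val_lt q
  rw [Nm_succ]; omega

lemma exists_eq_old_add (m : ℕ) (x : ZMod (Nm (m + 1))) :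
    ∃ q : ZMod (Nm m), ∃ r : ℕ, r < 5 ∧ x = old m q + r := by
  refine ⟨((x.val / 5 : ℕ) : ZMod (Nm m)), x.val % 5, Nat.mod_lt _ (by norm_num), ?_⟩
  rw [old_natCast, ← Nat.cast_add, Nat.div_add_mod, ZMod.natCast_zmod_val]

lemma forall_iff_forall_old_add (m : ℕ) (p : ZMod (Nm (m + 1)) → Prop) :
    (∀ x, p x) ↔ ∀ q, p (old m q) ∧ p (old m q + 1) ∧ p (old m q + 2) ∧ p (old m q + 3) ∧
      p (old m q + 4) := by
  refine ⟨fun h q => ⟨h _, h _, h _, h _, h _⟩, fun h x => ?_⟩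
  obtain ⟨q, r, hr, rfl⟩ := exists_eq_old_add m x
  obtain ⟨h0, h1, h2, h3, h4⟩ := h q
  interval_cases r <;> simpa

lemma partner_old (m : ℕ) (q : ZMod (Nm m)) :
    partner (m + 1) (old m q) = old m (partner m q) := by
  obtain ⟨k, a, ha, h, rfl⟩ := exists_eq_natCast_pow_mul m q
  have e : ∀ b, 5 * (5 ^ k * b) = 5 ^ (k + 1) * b := fun b => by ring
  rw [old_natCast, e, partner_natCast (m + 1) (k + 1) a ha
    (by rw [← e, Nm_succ]; exact Nat.mul_le_mul_left _ h), partner_natCast m k a ha h]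
  split_ifs <;> rw [old_natCast, e]

lemma partner_old_add (m r : ℕ) (hr0 : r ≠ 0) (hr : r < 5) (q : ZMod (Nm m)) :
    partner (m + 1) (old m q + r) =
      if r = 1 ∨ r = 3 then old m q + ((r + 1 : ℕ) : ZMod (Nm (m + 1)))
      else old m q + ((r - 1 : ℕ) : ZMod (Nm (m + 1))) := by
  have hq := ZMod.val_lt q
  have h := partner_natCast (m + 1) 0 (5 * q.val + r) (by omega) (by rw [Nm_succ]; omega)
  have hmod : (5 * q.val + r) % 5 = r := by omega
  rw [pow_zero, one_mul, one_mul, one_mul, hmod, Nat.add_sub_assoc (by omega), add_assoc] at h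
  simp only [Nat.cast_add (5 * q.val)] at h
  exact h

lemma partner_old_add_one (m : ℕ) (q : ZMod (Nm m)) :
    partner (m + 1) (old m q + 1) = old m q + 2 := by
  simpa using partner_old_add m 1 (by norm_num) (by norm_num) q

lemma partner_old_add_two (m : ℕ) (q : ZMod (Nm m)) :
    partner (m + 1) (old m q + 2) = old m q + 1 := by
  simpa using partner_old_add m 2 (by norm_num) (by norm_num) q

lemma partner_old_add_three (m : ℕ) (q : ZMod (Nm m)) :
    partner (m + 1) (old m q + 3) = old m q + 4 := by
  simpa using partner_old_add m 3 (by norm_num) (by norm_num) q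

lemma partner_old_add_four (m : ℕ) (q : ZMod (Nm m)) :
    partner (m + 1) (old m q + 4) = old m q + 3 := by
  simpa using partner_old_add m 4 (by norm_num) (by norm_num) q

lemma mem_eigensp_iff (m : ℕ) (lam : ℝ) (u : ZMod (Nm m) → ℝ) :
    u ∈ eigensp m lam ↔ (∀ x, lap m u x = lam * u x) ∧ ∀ x, u (partner m x) = u x := by
  rw [eigensp, Submodule.mem_inf, LinearMap.mem_ker, LinearMap.sub_apply, sub_eq_zero, funext_iff]
  rfl

lemma eq_of_forall_add_one_eq {α : Type*} {N : ℕ} [NeZero N] {f : ZMod N → α}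
    (h : ∀ q, f (q + 1) = f q) (q : ZMod N) : f q = f 0 := by
  have key : ∀ n : ℕ, f (n : ZMod N) = f 0 := by
    intro n
    induction n with
    | zero => simp
    | succ n ih => rw [Nat.cast_succ, h, ih]
  simpa using key q.val

lemma exists_sub_eq {N : ℕ} [NeZero N] (D : ZMod N → ℝ) (hD : ∑ q, D q = 0) (c : ℝ) :
    ∃ a : ZMod N → ℝ, a 0 = c ∧ ∀ q, a q - a (q - 1) = D q := by
  have htot : ∑ i ∈ Finset.range N, D (i : ZMod N) = 0 := by
    rw [← hD]
    refine Finset.sum_bij' (fun i _ => (i : ZMod N)) (fun q _ => q.val) ?_ ?_ ?_ ?_ ?_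
    · simp
    · intro q _; simpa using ZMod.val_lt q
    · intro i hi; exact ZMod.val_cast_of_lt (by simpa using hi)
    · simp
    · simp
  refine ⟨fun q => c - D 0 + ∑ i ∈ Finset.range (q.val + 1), D (i : ZMod N), by simp, ?_⟩
  intro q
  rcases Nat.eq_zero_or_pos q.val with h | h
  · obtain rfl : q = 0 := by simpa using h
    have hv : (0 - 1 : ZMod N).val + 1 = N := by
      obtain ⟨n, rfl⟩ := Nat.exists_eq_succ_of_ne_zero (NeZero.ne N)
      rw [zero_sub, ZMod.val_neg_one]
    simp only [hv, htot]
    simp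
  · have hv : (q - 1).val + 1 = q.val := by
      have : q - 1 = ((q.val - 1 : ℕ) : ZMod N) := by
        rw [Nat.cast_sub h]; simp
      rw [this, ZMod.val_cast_of_lt (by have := ZMod.val_lt q; omega)]
      omega
    simp only [hv, Finset.sum_range_succ]
    simp

lemma sum_eq_zero_of_partner_neg {m : ℕ} {D : ZMod (Nm m) → ℝ}
    (h : ∀ q, D (partner m q) = -D q) : ∑ q, D q = 0 := by
  have := Equiv.sum_comp (partner_involutive m).toPerm D
  simp only [Function.Involutive.coe_toPerm, h, Finset.sum_neg_distrib] at this
  linarith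

/-- On the cells of level `m`, a `3`-eigenfunction vanishes at the old vertices, is
antisymmetric in each cell, and its cellwise increments are antisymmetric under `partner`. -/
lemma mem_eigensp_three_iff (m : ℕ) (u : ZMod (Nm (m + 1)) → ℝ) :
    u ∈ eigensp (m + 1) 3 ↔ ∀ q : ZMod (Nm m), u (old m q) = 0 ∧
      u (old m q + 2) = u (old m q + 1) ∧ u (old m q + 3) = -u (old m q + 1) ∧
      u (old m q + 4) = -u (old m q + 1) ∧
      u (old m (partner m q) + 1) - u (old m (partner m q - 1) + 1) =
        -(u (old m q + 1) - u (old m (q - 1) + 1)) := by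
  rw [mem_eigensp_iff, forall_iff_forall_old_add m (fun x => lap (m + 1) u x = _),
    forall_iff_forall_old_add m (fun x => u (partner (m + 1) x) = u x)]
  simp only [lap, partner_old, partner_old_add_one, partner_old_add_two, partner_old_add_three,
    partner_old_add_four]
  have e (x : ZMod (Nm (m + 1))) : x + 1 + 1 = x + 2 ∧ x + 1 - 1 = x ∧ x + 2 + 1 = x + 3 ∧
      x + 2 - 1 = x + 1 ∧ x + 3 + 1 = x + 4 ∧ x + 3 - 1 = x + 2 ∧ x + 4 + 1 = x + 5 ∧
      x + 4 - 1 = x + 3 := by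
    refine ⟨?_, ?_, ?_, ?_, ?_, ?_, ?_, ?_⟩ <;> ring
  have e4 (q : ZMod (Nm m)) : old m q - 1 = old m (q - 1) + 4 := by rw [old_sub_one]; ring
  simp only [e, e4, ← old_add_one]
  constructor
  · rintro ⟨hl, hp⟩
    have hconst : ∀ q, u (old m q) = u (old m 0) :=
      eq_of_forall_add_one_eq (f := fun q => u (old m q)) fun q => by
        have := hl q; have := hp q; linarith
    have hrel : ∀ q, u (old m q + 4) = -u (old m 0) - u (old m q + 1) := fun q => by
      have := hl q; have := hp q; have := hconst q; linarith
    have hzero : u (old m 0) = 0 := by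
      have h1 : ∀ q, u (old m (partner m q) + 1) - u (old m (partner m q - 1) + 1)
          - 3 / 2 * u (old m 0)
          = -(u (old m q + 1) - u (old m (q - 1) + 1) - 3 / 2 * u (old m 0)) := fun q => by
        have := (hl q).1
        have := hrel (q - 1); have := hrel (partner m q - 1); have := hconst q
        linarith
      have h2 := sum_eq_zero_of_partner_neg
        (D := fun q => u (old m q + 1) - u (old m (q - 1) + 1) - 3 / 2 * u (old m 0)) h1
      have h3 := Equiv.sum_comp (Equiv.subRight (1 : ZMod (Nm m))) (fun q => u (old m q + 1))
      simp only [Equiv.subRight_apply] at h3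
      rw [Finset.sum_sub_distrib, Finset.sum_sub_distrib, h3] at h2
      simpa [NeZero.ne (Nm m)] using h2
    intro q
    have := hp q; have := hl q; have := hrel q; have := hconst q
    have := hrel (q - 1); have := hrel (partner m q - 1)
    refine ⟨?_, ?_, ?_, ?_, ?_⟩ <;> linarith
  · intro h
    refine ⟨fun q => ?_, fun q => ?_⟩
    · have := h q; have := h (q - 1); have := h (partner m q); have := h (partner m q - 1)
      have := h (q + 1)
      refine ⟨?_, ?_, ?_, ?_, ?_⟩ <;> linarith
    · have := h q; have := h (partner m q)
      refine ⟨?_, ?_, ?_, ?_, ?_⟩ <;> linarith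

/-- The value of `u` in the cell `0` together with its increments at the even cells. -/
def cellData (m : ℕ) : (ZMod (Nm (m + 1)) → ℝ) →ₗ[ℝ] ℝ × (Fin (5 ^ m) → ℝ) where
  toFun u := (u (old m 0 + 1), fun j =>
    u (old m ((2 * j : ℕ) : ZMod (Nm m)) + 1) - u (old m (((2 * j : ℕ) : ZMod (Nm m)) - 1) + 1))
  map_add' u v := by
    ext j
    · simp
    · simp only [Pi.add_apply, Prod.mk_add_mk]; ring
  map_smul' c u := by
    ext j
    · simp
    · simp only [Pi.smul_apply, smul_eq_mul, RingHom.id_apply, Prod.smul_mk]; ring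

lemma exists_eq_natCast_two_mul {m : ℕ} {q : ZMod (Nm m)} (h : q.val % 2 = 0) :
    ∃ j : Fin (5 ^ m), q = ((2 * j : ℕ) : ZMod (Nm m)) := by
  have hq : q.val < 2 * 5 ^ m := ZMod.val_lt q
  refine ⟨⟨q.val / 2, by omega⟩, ?_⟩
  have : 2 * (q.val / 2) = q.val := by omega
  simp only [this, ZMod.natCast_zmod_val]

lemma eq_zero_of_cellData_eq_zero (m : ℕ) (u : ZMod (Nm (m + 1)) → ℝ)
    (hu : u ∈ eigensp (m + 1) 3)
    (h : cellData m u = 0) : u = 0 := by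
  rw [mem_eigensp_three_iff] at hu
  obtain ⟨h0, h1⟩ := Prod.ext_iff.1 h
  have heven : ∀ q : ZMod (Nm m), q.val % 2 = 0 →
      u (old m q + 1) - u (old m (q - 1) + 1) = 0 := by
    intro q hq
    obtain ⟨j, rfl⟩ := exists_eq_natCast_two_mul hq
    exact congrFun h1 j
  have hall : ∀ q : ZMod (Nm m), u (old m q + 1) - u (old m (q - 1) + 1) = 0 := by
    intro q
    by_cases hq : q.val % 2 = 0
    · exact heven q hq
    · have := heven (partner m q) (by have := val_partner_mod_two m q; omega)
      linarith [(hu q).2.2.2.2]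
  have hz : ∀ q : ZMod (Nm m), u (old m q + 1) = 0 := fun q => by
    rw [eq_of_forall_add_one_eq (f := fun q => u (old m q + 1)) (fun q => by
      have := hall (q + 1)
      rw [add_sub_cancel_right] at this
      linarith) q]
    exact h0
  funext x
  revert x
  rw [forall_iff_forall_old_add m (fun x => u x = _)]
  intro q
  obtain ⟨a, b, c, d, -⟩ := hu q
  simp [a, b, c, d, hz]

lemma exists_mem_eigensp_cellData_eq (m : ℕ) (c : ℝ) (f : Fin (5 ^ m) → ℝ) :
    ∃ u ∈ eigensp (m + 1) 3, cellData m u = (c, f) := by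
  let g : ℕ → ℝ := fun n => if h : n < 5 ^ m then f ⟨n, h⟩ else 0
  let D : ZMod (Nm m) → ℝ := fun q =>
    if q.val % 2 = 0 then g (q.val / 2) else -g ((partner m q).val / 2)
  have hD : ∀ q, D (partner m q) = -D q := by
    intro q
    have := val_partner_mod_two m q
    simp only [D, partner_involutive m q]
    split_ifs <;> first | omega | simp
  obtain ⟨a, ha0, ha⟩ := exists_sub_eq D (sum_eq_zero_of_partner_neg hD) c
  let u : ZMod (Nm (m + 1)) → ℝ := fun x =>
    if x.val % 5 = 0 then 0
    else if x.val % 5 ≤ 2 then a ((x.val / 5 : ℕ) : ZMod (Nm m))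
    else -a ((x.val / 5 : ℕ) : ZMod (Nm m))
  have hu (r : ℕ) (hr : r < 5) (q : ZMod (Nm m)) :
      u (old m q + r) = if r = 0 then 0 else if r ≤ 2 then a q else -a q := by
    have h1 : (5 * q.val + r) % 5 = r := by omega
    have h2 : (5 * q.val + r) / 5 = q.val := by omega
    simp only [u, val_old_add m r hr, h1, h2, ZMod.natCast_zmod_val]
  have hu0 (q : ZMod (Nm m)) : u (old m q) = 0 := by simpa using hu 0 (by norm_num) q
  have hu1 (q : ZMod (Nm m)) : u (old m q + 1) = a q := by simpa using hu 1 (by norm_num) q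
  have hu2 (q : ZMod (Nm m)) : u (old m q + 2) = a q := by simpa using hu 2 (by norm_num) q
  have hu3 (q : ZMod (Nm m)) : u (old m q + 3) = -a q := by simpa using hu 3 (by norm_num) q
  have hu4 (q : ZMod (Nm m)) : u (old m q + 4) = -a q := by simpa using hu 4 (by norm_num) q
  refine ⟨u, ?_, ?_⟩
  · rw [mem_eigensp_three_iff]
    intro q
    simp only [hu0, hu1, hu2, hu3, hu4, ha, hD, and_self]
  · refine Prod.ext ?_ (funext fun j => ?_)
    · exact (hu1 0).trans ha0
    · have hj := j.isLt
      have hv : ((2 * j : ℕ) : ZMod (Nm m)).val = 2 * j :=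
        ZMod.val_cast_of_lt (by unfold Nm; omega)
      simp only [cellData, LinearMap.coe_mk, AddHom.coe_mk, hu1, ha, D, hv]
      simp [g]

/-- The `3`-eigenspace of `−Δ_{m+1}` has dimension `5^m + 1`, and its
elements vanish at all old vertices. -/
theorem eigenspace_three (m : ℕ) :
    Module.finrank ℝ ↥(eigensp (m + 1) 3) = 5 ^ m + 1 ∧
    ∀ u : ZMod (Nm (m + 1)) → ℝ, u ∈ eigensp (m + 1) 3 →
      ∀ n : ZMod (Nm m), u (((5 * n.val : ℕ) : ZMod (Nm (m + 1)))) = 0 := by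
  constructor
  · let F : eigensp (m + 1) 3 →ₗ[ℝ] ℝ × (Fin (5 ^ m) → ℝ) :=
      (cellData m).comp (eigensp (m + 1) 3).subtype
    have hF : Function.Bijective F := by
      constructor
      · rw [← LinearMap.ker_eq_bot, LinearMap.ker_eq_bot']
        exact fun u hu => Subtype.ext (eq_zero_of_cellData_eq_zero m u u.2 hu)
      · rintro ⟨c, f⟩
        obtain ⟨u, hu, h⟩ := exists_mem_eigensp_cellData_eq m c f
        exact ⟨⟨u, hu⟩, h⟩
    rw [(LinearEquiv.ofBijective F hF).finrank_eq]
    simp [add_comm]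
  · exact fun u hu n => ((mem_eigensp_three_iff m u).1 hu n).1

end VNLE
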